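/- Let W_1, …, W_n be distinct real numbers, let ρ ≥ 1, take the cost c(u,w) = |u − w|^ρ on ℝ × ℝ, and let θ lie in the interior of the convex hull of {W_1,…,W_n}. Then the RWP function for the mean-estimating equation satisfies the exact identity R_n(θ;ρ) := inf { D_c(P,P_n) : E_P[W] = θ } = | (1/n) Σ_{i=1}^n (W_i − θ) |^ρ. -/

import Mathlib

open MeasureTheory ProbabilityTheory Filter
open scoped ENNReal NNReal Topology

noncomputable section

/-- Optimal transport discrepancy with cost `c`. -/
def OTCost {α : Type*} [MeasurableSpace α] (c : α → α → ℝ≥0∞) (P Q : Measure α) : ℝ≥0∞ :=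
  ⨅ (π : Measure (α × α)) (_ : IsProbabilityMeasure π) (_ : π.map Prod.fst = P)
    (_ : π.map Prod.snd = Q), ∫⁻ z, c z.1 z.2 ∂π

/-- Empirical measure of the points `W 0, …, W (n-1)`. -/
def empMeas {α : Type*} [MeasurableSpace α] {n : ℕ} (W : Fin n → α) : Measure α :=
  (n : ℝ≥0∞)⁻¹ • ∑ i, Measure.dirac (W i)

lemma isProbabilityMeasure_empMeas {α : Type*} [MeasurableSpace α] {n : ℕ} (hn : 0 < n)
    (W : Fin n → α) : IsProbabilityMeasure (empMeas W) := by
  refine ⟨?_⟩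
  simp only [empMeas, Measure.smul_apply, Measure.finsetSum_apply, measure_univ, smul_eq_mul,
    Finset.sum_const, Finset.card_univ, Fintype.card_fin, nsmul_eq_mul, mul_one]
  exact ENNReal.inv_mul_cancel (by exact_mod_cast hn.ne') (ENNReal.natCast_ne_top n)

lemma integrable_empMeas {n : ℕ} (hn : 0 < n) (W : Fin n → ℝ) {f : ℝ → ℝ} :
    Integrable f (empMeas W) := by
  refine Integrable.smul_measure ?_ (ENNReal.inv_ne_top.2 (by exact_mod_cast hn.ne'))
  exact integrable_finsetSum_measure.2 fun i _ => integrable_dirac (by simp)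

lemma integral_empMeas {n : ℕ} (W : Fin n → ℝ) (f : ℝ → ℝ) :
    ∫ w, f w ∂(empMeas W) = (n : ℝ)⁻¹ * ∑ i, f (W i) := by
  rw [empMeas, integral_smul_measure, integral_finsetSum_measure]
  · simp
  · exact fun i _ => integrable_dirac (by simp)

/-- Jensen's inequality for the powers of the norm. -/
lemma enorm_integral_rpow_le {α : Type*} [MeasurableSpace α] (μ : Measure α)
    [IsProbabilityMeasure μ] {f : α → ℝ} (hf : AEStronglyMeasurable f μ) {ρ : ℝ} (hρ : 1 ≤ ρ) :
    ‖∫ z, f z ∂μ‖ₑ ^ ρ ≤ ∫⁻ z, ‖f z‖ₑ ^ ρ ∂μ := by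
  have hρ0 : 0 < ρ := by linarith
  have h := eLpNorm'_le_eLpNorm'_of_exponent_le one_pos hρ μ hf
  simp only [eLpNorm', ENNReal.rpow_one, div_one] at h
  calc ‖∫ z, f z ∂μ‖ₑ ^ ρ ≤ (∫⁻ z, ‖f z‖ₑ ∂μ) ^ ρ :=
        ENNReal.rpow_le_rpow (enorm_integral_le_lintegral_enorm f) hρ0.le
    _ ≤ ((∫⁻ z, ‖f z‖ₑ ^ ρ ∂μ) ^ (1 / ρ)) ^ ρ := ENNReal.rpow_le_rpow h hρ0.le
    _ = ∫⁻ z, ‖f z‖ₑ ^ ρ ∂μ := by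
        rw [← ENNReal.rpow_mul, one_div_mul_cancel hρ0.ne', ENNReal.rpow_one]

lemma ofReal_abs_rpow {x ρ : ℝ} (hρ : 0 ≤ ρ) : ENNReal.ofReal (|x| ^ ρ) = ‖x‖ₑ ^ ρ := by
  rw [← ENNReal.ofReal_rpow_of_nonneg (abs_nonneg x) hρ, Real.enorm_eq_ofReal_abs]

/-- For distinct real points `W 1, …, W n`, cost `c(u,w) = |u-w|^ρ` with
`ρ ≥ 1`, and `θ` in the interior of the convex hull of `{W 1, …, W n}`, the RWP function
for the mean-estimating equation `E_P[W - θ] = 0` equals `|(1/n) ∑ (W i - θ)|^ρ` exactly. -/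
theorem rwp_mean_estimating_equation
    (n : ℕ) (hn : 0 < n) (W : Fin n → ℝ) (hW : Function.Injective W)
    (ρ : ℝ) (hρ : 1 ≤ ρ)
    (c : ℝ → ℝ → ℝ≥0∞) (hc : ∀ u w : ℝ, c u w = ENNReal.ofReal (|u - w| ^ ρ))
    (θ : ℝ) (hθ : θ ∈ interior (convexHull ℝ (Set.range W))) :
    (⨅ (P : Measure ℝ) (_ : IsProbabilityMeasure P)
        (_ : Integrable (fun w => w - θ) P) (_ : (∫ w, w - θ ∂P) = 0),
        OTCost c P (empMeas W))
      = ENNReal.ofReal (|(n : ℝ)⁻¹ * ∑ i, (W i - θ)| ^ ρ) := by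
  have hρ0 : 0 ≤ ρ := by linarith
  have := isProbabilityMeasure_empMeas hn W
  set m := (n : ℝ)⁻¹ * ∑ i, (W i - θ) with hm
  have hemp : ∫ w, (w - θ) ∂(empMeas W) = m := integral_empMeas W fun w => w - θ
  apply le_antisymm
  · have hshift : Measurable fun w : ℝ => w - m := by fun_prop
    have hpair : Measurable fun w : ℝ => (w - m, w) := by fun_prop
    refine iInf_le_of_le ((empMeas W).map fun w => w - m) <|
      iInf_le_of_le (Measure.isProbabilityMeasure_map hshift.aemeasurable) <|
      iInf_le_of_le ?_ <| iInf_le_of_le ?_ <|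
      iInf_le_of_le ((empMeas W).map fun w => (w - m, w)) <|
      iInf_le_of_le (Measure.isProbabilityMeasure_map hpair.aemeasurable) <|
      iInf_le_of_le ?_ <| iInf_le_of_le ?_ ?_
    · exact (integrable_map_measure (by fun_prop) hshift.aemeasurable).2 (integrable_empMeas hn W)
    · rw [integral_map hshift.aemeasurable (by fun_prop)]
      simp only [sub_right_comm _ m θ]
      rw [integral_sub (integrable_empMeas hn W) (integrable_const m), hemp]
      simp
    · rw [Measure.map_map measurable_fst hpair]
      rfl
    · rw [Measure.map_map measurable_snd hpair]
      exact Measure.map_id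
    · simp only [hc]
      rw [lintegral_map (by fun_prop) hpair]
      simp
  · refine le_iInf fun P => le_iInf fun _ => le_iInf fun hint => le_iInf fun hmean =>
      le_iInf fun π => le_iInf fun _ => le_iInf fun hfst => le_iInf fun hsnd => ?_
    have hint₁ : Integrable (fun z : ℝ × ℝ => z.1 - θ) π := by
      rw [← hfst] at hint
      exact hint.comp_measurable measurable_fst
    have hint₂ : Integrable (fun z : ℝ × ℝ => z.2 - θ) π := by
      have h : Integrable (fun w => w - θ) (π.map Prod.snd) := by
        rw [hsnd]
        exact integrable_empMeas hn W
      exact h.comp_measurable measurable_snd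
    have hmean₁ : ∫ z, (z.1 - θ) ∂π = 0 := by
      rw [← hmean, ← hfst, integral_map measurable_fst.aemeasurable (by fun_prop)]
    have hmean₂ : ∫ z, (z.2 - θ) ∂π = m := by
      rw [← hemp, ← hsnd, integral_map measurable_snd.aemeasurable (by fun_prop)]
    have hdiff : ∫ z, (z.1 - z.2) ∂π = -m := by
      rw [← zero_sub, ← hmean₁, ← hmean₂, ← integral_sub hint₁ hint₂]
      simp
    simp only [hc, ofReal_abs_rpow hρ0]
    rw [← enorm_neg m, ← hdiff]
    exact enorm_integral_rpow_le π (by fun_prop) hρ
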